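/- Let Φ, Ψ : [c,d] → ℝ be smooth, suppose Φ'' does not change sign on [c,d], and suppose |Φ^{(i)}(x)| ≥ Λ for all x ∈ [c,d] for some integer i ≥ 1 and real Λ > 0. Then |∫_c^d e^{2πiΦ(x)} Ψ(x) dx| ≤ C_i (|Ψ(d)| + ∫_c^d |Ψ'(x)| dx) Λ^{−1/i}, where C_i depends only on i. -/

import Mathlib

open MeasureTheory intervalIntegral Set

lemma vdc_exp_norm (t : ℝ) : ‖Complex.exp (2 * Real.pi * Complex.I * (t : ℂ))‖ = 1 := by
  have : (2 * Real.pi * Complex.I * (t : ℂ)) = ((2 * Real.pi * t : ℝ) : ℂ) * Complex.I := by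
    push_cast; ring
  rw [this, Complex.norm_exp_ofReal_mul_I]

lemma vdc_cont (f : ℝ → ℝ) (s : Set ℝ) (hf : ContinuousOn f s) :
    ContinuousOn (fun x => Complex.exp (2 * Real.pi * Complex.I * (f x : ℂ))) s := by
  have := Complex.continuous_ofReal.comp_continuousOn hf
  exact Complex.continuous_exp.comp_continuousOn (continuousOn_const.mul this)

lemma vdc_min (c d lam : ℝ) (h h' : ℝ → ℝ) (hcd : c ≤ d)
    (hc : ContinuousOn h (Icc c d)) (hd : ∀ x ∈ Ioo c d, HasDerivAt h (h' x) x)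
    (hl : ∀ x ∈ Icc c d, lam ≤ |h' x|) :
    ∃ x₀ ∈ Icc c d, ∀ x ∈ Icc c d, lam * |x - x₀| ≤ |h x| := by
  have mvt : ∀ x ∈ Icc c d, ∀ y ∈ Icc c d, x < y → lam * |y - x| ≤ |h y - h x| := by
    intro x hx y hy hxy
    obtain ⟨z, hz, e⟩ := exists_hasDerivAt_eq_slope h h' hxy
      (hc.mono (Icc_subset_Icc hx.1 hy.2))
      (fun z hz => hd z ⟨lt_of_le_of_lt hx.1 hz.1, lt_of_lt_of_le hz.2 hy.2⟩)
    have h1 := hl z ⟨hx.1.trans hz.1.le, hz.2.le.trans hy.2⟩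
    have h2 : h y - h x = h' z * (y - x) := by
      rw [e]; field_simp [sub_ne_zero.2 hxy.ne']
    rw [h2, abs_mul]
    gcongr
  have mvt2 : ∀ x ∈ Icc c d, ∀ y ∈ Icc c d, lam * |y - x| ≤ |h y - h x| := by
    intro x hx y hy
    rcases lt_trichotomy x y with h1 | h1 | h1
    · exact mvt x hx y hy h1
    · simp [h1]
    · rw [abs_sub_comm, abs_sub_comm (h y)]; exact mvt y hy x hx h1
  obtain ⟨x₀, hx₀, hm⟩ := isCompact_Icc.exists_isMinOn (nonempty_Icc.2 hcd) hc.abs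
  refine ⟨x₀, hx₀, fun x hx => (mvt2 x₀ hx₀ x hx).trans ?_⟩
  have hmx : |h x₀| ≤ |h x| := hm hx
  by_cases h0 : h x₀ = 0
  · simp [h0]
  have nz : ∀ y ∈ Icc c d, h y ≠ 0 := by
    intro y hy hy0
    have : |h x₀| ≤ |h y| := hm hy
    rw [hy0, abs_zero] at this
    exact h0 (abs_nonpos_iff.1 this)
  have hsub : uIcc x₀ x ⊆ Icc c d := uIcc_subset_Icc hx₀ hx
  have ivt := intermediate_value_uIcc (hc.mono hsub)
  have key : (0:ℝ) ∉ uIcc (h x₀) (h x) := by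
    intro hmem
    obtain ⟨y, hy, hy0⟩ := ivt hmem
    exact nz y (hsub hy) hy0
  rw [mem_uIcc] at key
  push Not at key
  rcases lt_or_gt_of_ne h0 with hn | hp
  · have : h x < 0 := key.1 hn.le
    rw [abs_of_neg hn, abs_of_neg this] at hmx
    rw [abs_of_neg this, abs_le]; constructor <;> linarith
  · have : 0 < h x := by
      by_contra hh
      push Not at hh
      linarith [key.2 hh]
    rw [abs_of_pos hp, abs_of_pos this] at hmx
    rw [abs_of_pos this, abs_le]; constructor <;> linarith

lemma vdc_base (c d : ℝ) (g : ℕ → ℝ → ℝ) (lam : ℝ) (hcd : c ≤ d)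
    (hc : ∀ n, ContinuousOn (g n) (Icc c d))
    (hd : ∀ n, ∀ x ∈ Ioo c d, HasDerivAt (g n) (g (n+1) x) x)
    (hs : (∀ x ∈ Icc c d, 0 ≤ g 2 x) ∨ (∀ x ∈ Icc c d, g 2 x ≤ 0))
    (hl0 : 0 < lam) (hl : ∀ x ∈ Icc c d, lam ≤ |g 1 x|) :
    ‖∫ x in c..d, Complex.exp (2 * Real.pi * Complex.I * (g 0 x : ℂ))‖ ≤ 4 * lam⁻¹ := by
  have nz : ∀ x ∈ Icc c d, g 1 x ≠ 0 := fun x hx => abs_pos.1 (hl0.trans_le (hl x hx))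
  set E : ℝ → ℂ := fun x => Complex.exp (2 * Real.pi * Complex.I * (g 0 x : ℂ)) with hE
  have hEc : ContinuousOn E (Icc c d) := vdc_cont _ _ (hc 0)
  have hEn : ∀ x, ‖E x‖ = 1 := fun x => vdc_exp_norm _
  set w : ℝ → ℝ := fun x => (g 1 x)⁻¹ with hw
  set w' : ℝ → ℝ := fun x => -(g 2 x) / (g 1 x)^2 with hw'
  have hwc : ContinuousOn w (Icc c d) := (hc 1).inv₀ nz
  have hw'c : ContinuousOn w' (Icc c d) :=
    (hc 2).neg.div ((hc 1).pow 2) (fun x hx => pow_ne_zero 2 (nz x hx))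
  have hwd : ∀ x ∈ Ioo c d, HasDerivAt w (w' x) x := fun x hx =>
    (hd 1 x hx).fun_inv (nz x (Ioo_subset_Icc_self hx))
  have hwb : ∀ x ∈ Icc c d, |w x| ≤ lam⁻¹ := by
    intro x hx
    rw [hw, abs_inv]
    exact inv_anti₀ hl0 (hl x hx)
  have hIw' : ∫ x in c..d, w' x = w d - w c :=
    integral_eq_sub_of_hasDerivAt_of_le hcd hwc hwd (hw'c.intervalIntegrable_of_Icc hcd)
  have hwabs : ∫ x in c..d, |w' x| ≤ 2 * lam⁻¹ := by
    have b1 := abs_le.1 (hwb d (right_mem_Icc.2 hcd))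
    have b2 := abs_le.1 (hwb c (left_mem_Icc.2 hcd))
    rcases hs with hs | hs
    · have : ∫ x in c..d, |w' x| = ∫ x in c..d, - w' x := by
        apply integral_congr
        intro x hx
        rw [uIcc_of_le hcd] at hx
        refine abs_of_nonpos ?_
        exact div_nonpos_of_nonpos_of_nonneg (by linarith [hs x hx]) (sq_nonneg _)
      rw [this, intervalIntegral.integral_neg, hIw']; linarith [b1.1, b1.2, b2.1, b2.2]
    · have : ∫ x in c..d, |w' x| = ∫ x in c..d, w' x := by
        apply integral_congr
        intro x hx
        rw [uIcc_of_le hcd] at hx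
        refine abs_of_nonneg ?_
        exact div_nonneg (by linarith [hs x hx]) (sq_nonneg _)
      rw [this, hIw']; linarith [b1.1, b1.2, b2.1, b2.2]
  have hpi : (2 * Real.pi * Complex.I : ℂ) ≠ 0 := by
    simp [Real.pi_ne_zero]
  have hpin : ‖(2 * Real.pi * Complex.I : ℂ)⁻¹‖ ≤ 1 := by
    rw [norm_inv]
    apply inv_le_one_of_one_le₀
    simp only [norm_mul, Complex.norm_I, Complex.norm_real, Complex.norm_ofNat, mul_one]
    rw [Real.norm_of_nonneg Real.pi_pos.le]
    linarith [Real.pi_gt_three]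
  set K : ℂ := (2 * Real.pi * Complex.I : ℂ)⁻¹ with hK
  have hu := Complex.continuous_ofReal.comp_continuousOn hwc
  have hu' := Complex.continuous_ofReal.comp_continuousOn hw'c
  have hg1 := Complex.continuous_ofReal.comp_continuousOn (hc 1)
  have hvn : ∀ x, ‖K * E x‖ ≤ 1 := by
    intro x; rw [norm_mul, hEn, mul_one]; exact hpin
  have ibp := integral_mul_deriv_eq_deriv_mul_of_hasDerivAt (a := c) (b := d)
    (u := fun x => (w x : ℂ)) (u' := fun x => (w' x : ℂ))
    (v := fun x => K * E x) (v' := fun x => E x * (g 1 x : ℂ))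
    (by rw [uIcc_of_le hcd]; exact hu)
    (by rw [uIcc_of_le hcd]; exact continuousOn_const.mul hEc)
    (by rw [min_eq_left hcd, max_eq_right hcd]; intro x hx; exact (hwd x hx).ofReal_comp)
    (by
      rw [min_eq_left hcd, max_eq_right hcd]; intro x hx
      have := (((hd 0 x hx).ofReal_comp).const_mul (2 * Real.pi * Complex.I : ℂ)).cexp.const_mul K
      convert this using 1
      rw [hK]; field_simp
      exact mul_comm _ _)
    (ContinuousOn.intervalIntegrable_of_Icc hcd hu')
    (ContinuousOn.intervalIntegrable_of_Icc hcd (hEc.mul hg1))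
  have e1 : ∫ x in c..d, E x = ∫ x in c..d, (w x : ℂ) * (E x * (g 1 x : ℂ)) := by
    apply integral_congr
    intro x hx
    rw [uIcc_of_le hcd] at hx
    have : (g 1 x : ℂ) ≠ 0 := by exact_mod_cast nz x hx
    simp only [hw]; push_cast; field_simp
  rw [e1, ibp]
  have n1 : ∀ x ∈ Icc c d, ‖(w x : ℂ) * (K * E x)‖ ≤ lam⁻¹ := by
    intro x hx
    rw [norm_mul, Complex.norm_real, Real.norm_eq_abs]
    calc _ ≤ lam⁻¹ * 1 := mul_le_mul (hwb x hx) (hvn x) (norm_nonneg _) (by positivity)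
      _ = _ := mul_one _
  have n2 : ‖∫ x in c..d, (w' x : ℂ) * (K * E x)‖ ≤ ∫ x in c..d, |w' x| := by
    apply intervalIntegral.norm_integral_le_of_norm_le hcd
    · refine Filter.Eventually.of_forall fun x _ => ?_
      rw [norm_mul, Complex.norm_real, Real.norm_eq_abs]
      exact mul_le_of_le_one_right (abs_nonneg _) (hvn x)
    · exact hw'c.abs.intervalIntegrable_of_Icc hcd
  have := n1 d (right_mem_Icc.2 hcd)
  have := n1 c (left_mem_Icc.2 hcd)
  refine (norm_sub_le _ _).trans ?_
  have := norm_sub_le ((w d : ℂ) * (K * E d)) ((w c : ℂ) * (K * E c))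
  linarith

lemma vdc_main (k : ℕ) (hk : 1 ≤ k) : ∃ C : ℝ, 0 < C ∧
    ∀ (c d : ℝ) (g : ℕ → ℝ → ℝ) (lam : ℝ), c ≤ d →
    (∀ n, ContinuousOn (g n) (Icc c d)) →
    (∀ n, ∀ x ∈ Ioo c d, HasDerivAt (g n) (g (n+1) x) x) →
    ((∀ x ∈ Icc c d, 0 ≤ g 2 x) ∨ (∀ x ∈ Icc c d, g 2 x ≤ 0)) →
    0 < lam → (∀ x ∈ Icc c d, lam ≤ |g k x|) →
    ‖∫ x in c..d, Complex.exp (2 * Real.pi * Complex.I * (g 0 x : ℂ))‖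
      ≤ C * lam ^ (-(1:ℝ) / k) := by
  induction k, hk using Nat.le_induction with
  | base =>
    refine ⟨4, by norm_num, fun c d g lam hcd hc hd hs hl0 hl => ?_⟩
    have := vdc_base c d g lam hcd hc hd hs hl0 hl
    simpa [Real.rpow_neg_one] using this
  | succ k hk ih =>
    obtain ⟨C, hC, ih⟩ := ih
    refine ⟨2 * C + 2, by positivity, fun c d g lam hcd hc hd hs hl0 hl => ?_⟩
    obtain ⟨x₀, hx₀, hx⟩ := vdc_min c d lam (g k) (g (k+1)) hcd (hc k) (hd k) hl
    have hk0 : (0:ℝ) < k := by exact_mod_cast hk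
    set δ : ℝ := lam ^ (-(1:ℝ) / ((k+1 : ℕ) : ℝ)) with hδ
    have hδ0 : 0 < δ := Real.rpow_pos_of_pos hl0 _
    have hpow : (lam * δ) ^ (-(1:ℝ) / k) = δ := by
      have : lam * δ = lam ^ (1 + -(1:ℝ) / ((k+1 : ℕ) : ℝ)) := by
        rw [Real.rpow_add hl0, Real.rpow_one]
      rw [this, ← Real.rpow_mul hl0.le, hδ]
      congr 1
      push_cast
      field_simp
      ring
    set E : ℝ → ℂ := fun x => Complex.exp (2 * Real.pi * Complex.I * (g 0 x : ℂ)) with hE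
    have hEc : ContinuousOn E (Icc c d) := vdc_cont _ _ (hc 0)
    have sub : ∀ a b, c ≤ a → a ≤ b → b ≤ d → (∀ x ∈ Icc a b, δ ≤ |x - x₀|) →
        ‖∫ x in a..b, E x‖ ≤ C * δ := by
      intro a b ha hab hb hfar
      have hsub : Icc a b ⊆ Icc c d := Icc_subset_Icc ha hb
      have := ih a b g (lam * δ) hab (fun n => (hc n).mono hsub)
        (fun n x hx => hd n x ⟨ha.trans_lt hx.1, hx.2.trans_le hb⟩)
        (hs.imp (fun h x hx => h x (hsub hx)) (fun h x hx => h x (hsub hx)))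
        (by positivity)
        (fun x hxx => le_trans (mul_le_mul_of_nonneg_left (hfar x hxx) hl0.le) (hx x (hsub hxx)))
      rwa [hpow] at this
    set a := max c (x₀ - δ) with ha
    set b := min d (x₀ + δ) with hb
    have hca : c ≤ a := le_max_left _ _
    have hbd : b ≤ d := min_le_left _ _
    have hax : a ≤ x₀ := max_le hx₀.1 (by linarith)
    have hxb : x₀ ≤ b := le_min hx₀.2 (by linarith)
    have hab : a ≤ b := hax.trans hxb
    have hC0 : 0 ≤ C * δ := by positivity
    have I1 : ‖∫ x in c..a, E x‖ ≤ C * δ := by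
      rcases le_total c (x₀ - δ) with h | h
      · have : a = x₀ - δ := max_eq_right h
        apply sub c a le_rfl hca (hab.trans hbd)
        intro x hx
        rw [abs_sub_comm]
        exact le_trans (by linarith [hx.2]) (le_abs_self _)
      · have : a = c := max_eq_left h
        rw [this]; simpa using hC0
    have I3 : ‖∫ x in b..d, E x‖ ≤ C * δ := by
      rcases le_total d (x₀ + δ) with h | h
      · have : b = d := min_eq_left h
        rw [this]; simpa using hC0
      · have : b = x₀ + δ := min_eq_right h
        apply sub b d (hca.trans hab) hbd le_rfl
        intro x hx
        exact le_trans (by linarith [hx.1]) (le_abs_self _)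
    have I2 : ‖∫ x in a..b, E x‖ ≤ 2 * δ := by
      have := intervalIntegral.norm_integral_le_of_norm_le_const (a := a) (b := b) (f := E)
        (C := 1) (fun x _ => (vdc_exp_norm _).le)
      rw [abs_of_nonneg (by linarith)] at this
      have h1 : x₀ - δ ≤ a := le_max_right _ _
      have h2 : b ≤ x₀ + δ := min_le_right _ _
      linarith
    have ii : ∀ p q, c ≤ p → p ≤ q → q ≤ d → IntervalIntegrable E volume p q :=
      fun p q h1 h2 h3 => (hEc.mono (Icc_subset_Icc h1 h3)).intervalIntegrable_of_Icc h2
    have i1 := ii c a le_rfl hca (hab.trans hbd)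
    have i2 := ii a b hca hab hbd
    have i3 := ii b d (hca.trans hab) hbd le_rfl
    rw [← integral_add_adjacent_intervals (i1.trans i2) i3,
      ← integral_add_adjacent_intervals i1 i2]
    have := norm_add₃_le (a := ∫ x in c..a, E x) (b := ∫ x in a..b, E x) (c := ∫ x in b..d, E x)
    linarith

/-- van der Corput's lemma with amplitude: if `|Φ⁽ⁱ⁾| ≥ Λ` on `[c,d]` and `Φ''`
does not change sign, then
`|∫_c^d e(Φ(x)) Ψ(x) dx| ≤ C_i (|Ψ(d)| + ∫_c^d |Ψ'|) Λ^(-1/i)`. -/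
theorem stmt_8 (i : ℕ) (hi : 1 ≤ i) :
    ∃ C : ℝ, 0 < C ∧
      ∀ (c d : ℝ) (Φ Ψ : ℝ → ℝ) (Λ : ℝ), c ≤ d →
        ContDiffOn ℝ (⊤ : ℕ∞) Φ (Set.Icc c d) →
        ContDiffOn ℝ (⊤ : ℕ∞) Ψ (Set.Icc c d) →
        ((∀ x ∈ Set.Icc c d, 0 ≤ iteratedDeriv 2 Φ x) ∨
          (∀ x ∈ Set.Icc c d, iteratedDeriv 2 Φ x ≤ 0)) →
        0 < Λ →
        (∀ x ∈ Set.Icc c d, Λ ≤ |iteratedDeriv i Φ x|) →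
        ‖∫ x in c..d, Complex.exp (2 * Real.pi * Complex.I * (Φ x)) * (Ψ x : ℂ)‖ ≤
          C * (|Ψ d| + ∫ x in c..d, |deriv Ψ x|) * Λ ^ (-(1 : ℝ) / i) := by
  obtain ⟨C, hC, H⟩ := vdc_main i hi
  refine ⟨C, hC, fun c d Φ Ψ Λ hcd hΦ hΨ hs hΛ hl => ?_⟩
  rcases hcd.eq_or_lt with rfl | hlt
  · simp only [intervalIntegral.integral_same, norm_zero]
    positivity
  have huniq : UniqueDiffOn ℝ (Icc c d) := uniqueDiffOn_Icc hlt
  set g : ℕ → ℝ → ℝ := fun n => iteratedDerivWithin n Φ (Icc c d) with hg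
  have hg0 : g 0 = Φ := by simp [hg]
  have hc : ∀ n, ContinuousOn (g n) (Icc c d) := fun n =>
    hΦ.continuousOn_iteratedDerivWithin (by exact_mod_cast le_top) huniq
  have hd : ∀ n, ∀ x ∈ Ioo c d, HasDerivAt (g n) (g (n+1) x) x := by
    intro n x hx
    have h1 := hΦ.differentiableOn_iteratedDerivWithin (m := n)
      (by exact_mod_cast WithTop.coe_lt_top n) huniq x (Ioo_subset_Icc_self hx)
    have h2 := h1.hasDerivWithinAt.hasDerivAt (Icc_mem_nhds hx.1 hx.2)
    simpa only [hg, iteratedDerivWithin_succ] using h2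
  have heq : ∀ n, ∀ x ∈ Ioo c d, iteratedDeriv n Φ x = g n x := by
    intro n
    induction n with
    | zero => intro x _; simp [hg0]
    | succ n ih =>
      intro x hx
      rw [iteratedDeriv_succ, ← (hd n x hx).deriv]
      apply Filter.EventuallyEq.deriv_eq
      filter_upwards [Ioo_mem_nhds hx.1 hx.2] with y hy using ih y hy
  have hcl : closure (Ioo c d) = Icc c d := closure_Ioo hlt.ne
  have hs' : (∀ x ∈ Icc c d, 0 ≤ g 2 x) ∨ (∀ x ∈ Icc c d, g 2 x ≤ 0) := by
    refine hs.imp (fun h x hx => ?_) (fun h x hx => ?_)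
    · exact le_on_closure (s := Ioo c d) (f := fun _ => 0) (g := g 2)
        (fun y hy => by rw [← heq 2 y hy]; exact h y (Ioo_subset_Icc_self hy))
        continuousOn_const (hcl ▸ hc 2) (hcl ▸ hx)
    · exact le_on_closure (s := Ioo c d) (f := g 2) (g := fun _ => 0)
        (fun y hy => by rw [← heq 2 y hy]; exact h y (Ioo_subset_Icc_self hy))
        (hcl ▸ hc 2) continuousOn_const (hcl ▸ hx)
  have hl' : ∀ x ∈ Icc c d, Λ ≤ |g i x| := fun x hx =>
    le_on_closure (s := Ioo c d) (f := fun _ => Λ) (g := fun x => |g i x|)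
        (fun y hy => by rw [← heq i y hy]; exact hl y (Ioo_subset_Icc_self hy))
        continuousOn_const (hcl ▸ (hc i).abs) (hcl ▸ hx)
  set E : ℝ → ℂ := fun x => Complex.exp (2 * Real.pi * Complex.I * (Φ x : ℂ)) with hE
  have hEc : ContinuousOn E (Icc c d) := vdc_cont _ _ hΦ.continuousOn
  set M : ℝ := C * Λ ^ (-(1 : ℝ) / i) with hM
  have hF : ∀ t ∈ Icc c d, ‖∫ x in c..t, E x‖ ≤ M := by
    intro t ht
    have hsub : Icc c t ⊆ Icc c d := Icc_subset_Icc le_rfl ht.2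
    have := H c t g Λ ht.1 (fun n => (hc n).mono hsub)
        (fun n x hx => hd n x ⟨hx.1, hx.2.trans_le ht.2⟩)
        (hs'.imp (fun h x hx => h x (hsub hx)) (fun h x hx => h x (hsub hx)))
        hΛ (fun x hx => hl' x (hsub hx))
    rwa [hg0] at this
  have hM0 : 0 ≤ M := (norm_nonneg _).trans (hF d (right_mem_Icc.2 hcd))
  have hP'c : ContinuousOn (derivWithin Ψ (Icc c d)) (Icc c d) :=
    hΨ.continuousOn_derivWithin huniq (by exact_mod_cast le_top)
  have hPd : ∀ x ∈ Ioo c d, HasDerivAt Ψ (derivWithin Ψ (Icc c d) x) x := by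
    intro x hx
    exact (hΨ.differentiableOn (by simp) x (Ioo_subset_Icc_self hx)).hasDerivWithinAt.hasDerivAt
      (Icc_mem_nhds hx.1 hx.2)
  have hint : ∫ x in c..d, |deriv Ψ x| = ∫ x in c..d, |derivWithin Ψ (Icc c d) x| := by
    apply integral_congr_Ioo_of_le hcd
    intro x hx
    simp only [(hPd x hx).deriv]
  have hEi : IntervalIntegrable E volume c d := hEc.intervalIntegrable_of_Icc hcd
  have hP'cc := Complex.continuous_ofReal.comp_continuousOn hP'c
  have ibp := integral_mul_deriv_eq_deriv_mul_of_hasDerivAt (a := c) (b := d)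
    (u := fun x => (Ψ x : ℂ)) (u' := fun x => ((derivWithin Ψ (Icc c d) x : ℝ) : ℂ))
    (v := fun t => ∫ x in c..t, E x) (v' := E)
    (by rw [uIcc_of_le hcd]; exact Complex.continuous_ofReal.comp_continuousOn hΨ.continuousOn)
    (continuousOn_primitive_interval' hEi left_mem_uIcc)
    (by rw [min_eq_left hcd, max_eq_right hcd]; intro x hx; exact (hPd x hx).ofReal_comp)
    (by
      rw [min_eq_left hcd, max_eq_right hcd]; intro x hx
      apply integral_hasDerivAt_right
      · exact (hEc.mono (Icc_subset_Icc le_rfl hx.2.le)).intervalIntegrable_of_Icc hx.1.le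
      · exact (hEc.mono Ioo_subset_Icc_self).stronglyMeasurableAtFilter isOpen_Ioo x hx
      · exact hEc.continuousAt (Icc_mem_nhds hx.1 hx.2))
    (ContinuousOn.intervalIntegrable_of_Icc hcd hP'cc) hEi
  have e1 : ∫ x in c..d, E x * (Ψ x : ℂ) = ∫ x in c..d, (Ψ x : ℂ) * E x := by
    simp only [mul_comm]
  change ‖∫ x in c..d, E x * (Ψ x : ℂ)‖ ≤ _
  rw [e1, ibp, hint]
  have n1 : ‖(Ψ d : ℂ) * ∫ x in c..d, E x‖ ≤ |Ψ d| * M := by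
    rw [norm_mul, Complex.norm_real, Real.norm_eq_abs]
    exact mul_le_mul_of_nonneg_left (hF d (right_mem_Icc.2 hcd)) (abs_nonneg _)
  have n2 : ‖∫ t in c..d, ((derivWithin Ψ (Icc c d) t : ℝ) : ℂ) * ∫ x in c..t, E x‖
      ≤ ∫ t in c..d, |derivWithin Ψ (Icc c d) t| * M := by
    apply intervalIntegral.norm_integral_le_of_norm_le hcd
    · refine Filter.Eventually.of_forall fun x hx => ?_
      rw [norm_mul, Complex.norm_real, Real.norm_eq_abs]
      exact mul_le_mul_of_nonneg_left (hF x (Ioc_subset_Icc_self hx)) (abs_nonneg _)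
    · exact (hP'c.abs.mul continuousOn_const).intervalIntegrable_of_Icc hcd
  rw [intervalIntegral.integral_mul_const] at n2
  simp only [intervalIntegral.integral_same, mul_zero, sub_zero]
  refine (norm_sub_le _ _).trans ((add_le_add n1 n2).trans_eq ?_)
  rw [hM]; ring
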